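/- Let u ∈ (0,1), m ∈ (1,∞), μ = 1/m, μ₁ = 1 − μ, and abbreviate s = sn(K(μ)u|μ), c = cn(K(μ)u|μ), d = dn(K(μ)u|μ), s₁ = sn(K(μ₁)u|μ₁), c₁ = cn(K(μ₁)u|μ₁), d₁ = dn(K(μ₁)u|μ₁). Then the identity μ·(s²d₁² + c²d²s₁²c₁²)/(1 − d²s₁²)² = 1 − (c²c₁²/(1 − d²s₁²))·(1 − φ(u,μ)) holds, where φ(u,μ) = (d₁/c₁)² − (d/c)²; equivalently, the continuously extended modulus satisfies |sn(K(m)u|m)|² = 1 − (c²c₁²/(1 − d²s₁²))·(1 − φ(u,μ)). -/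

import Mathlib

noncomputable section

open Complex Filter Set Asymptotics

/-- Complete elliptic integral of the first kind with complex parameter `m`,
using the principal branch of the square root. -/
def ellK (m : ℂ) : ℂ :=
  ∫ t in (0:ℝ)..1, 1 / ((1 - (t : ℂ) ^ 2) * (1 - m * (t : ℂ) ^ 2)) ^ ((1 : ℂ) / 2)

/-- The nome `q = exp (-π K(1-m)/K(m))`. -/
def nome (m : ℂ) : ℂ := Complex.exp (-(Real.pi : ℂ) * ellK (1 - m) / ellK m)

/-- Jacobi theta function θ₁(z, q). -/
def theta1 (z q : ℂ) : ℂ :=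
  2 * ∑' n : ℕ, (-1 : ℂ) ^ n * q ^ (((n : ℂ) + 1 / 2) ^ 2) *
    Complex.sin ((2 * (n : ℂ) + 1) * z)

/-- Jacobi theta function θ₂(z, q). -/
def theta2 (z q : ℂ) : ℂ :=
  2 * ∑' n : ℕ, q ^ (((n : ℂ) + 1 / 2) ^ 2) * Complex.cos ((2 * (n : ℂ) + 1) * z)

/-- Jacobi theta function θ₃(z, q). -/
def theta3 (z q : ℂ) : ℂ :=
  1 + 2 * ∑' n : ℕ, q ^ ((n + 1) ^ 2) * Complex.cos (2 * ((n : ℂ) + 1) * z)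

/-- Jacobi theta function θ₄(z, q). -/
def theta4 (z q : ℂ) : ℂ :=
  1 + 2 * ∑' n : ℕ, (-1 : ℂ) ^ (n + 1) * q ^ ((n + 1) ^ 2) *
    Complex.cos (2 * ((n : ℂ) + 1) * z)

/-- Jacobian elliptic function sn(z | m) with complex argument and parameter,
defined through quotients of Jacobi theta functions with nome
`q = exp (-π K(1-m)/K(m))` (so that `sn (K m * u) m` corresponds to the
theta quotient at `π u / 2`). -/
def sn (z m : ℂ) : ℂ :=
  (theta3 0 (nome m) / theta2 0 (nome m)) *
    (theta1 ((Real.pi : ℂ) * z / (2 * ellK m)) (nome m) /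
      theta4 ((Real.pi : ℂ) * z / (2 * ellK m)) (nome m))

/-- Jacobian elliptic function cn(z | m). -/
def cn (z m : ℂ) : ℂ :=
  (theta4 0 (nome m) / theta2 0 (nome m)) *
    (theta2 ((Real.pi : ℂ) * z / (2 * ellK m)) (nome m) /
      theta4 ((Real.pi : ℂ) * z / (2 * ellK m)) (nome m))

/-- Jacobian elliptic function dn(z | m). -/
def dn (z m : ℂ) : ℂ :=
  (theta4 0 (nome m) / theta3 0 (nome m)) *
    (theta3 ((Real.pi : ℂ) * z / (2 * ellK m)) (nome m) /
      theta4 ((Real.pi : ℂ) * z / (2 * ellK m)) (nome m))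

/-- The lattice ratio τ = i K(1-m)/K(m). -/
def tauC (m : ℂ) : ℂ := Complex.I * ellK (1 - m) / ellK m

/-- Subsidiary Jacobian elliptic function sc = sn/cn. -/
def sc (z m : ℂ) : ℂ := sn z m / cn z m

/-- Subsidiary Jacobian elliptic function nc = 1/cn. -/
def nc (z m : ℂ) : ℂ := 1 / cn z m

/-- Subsidiary Jacobian elliptic function dc = dn/cn. -/
def dcC (z m : ℂ) : ℂ := dn z m / cn z m

/-- The branch cut [1, ∞) on the real axis. -/
def cut : Set ℂ := {z : ℂ | z.im = 0 ∧ 1 ≤ z.re}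

/-- Real complete elliptic integral of the first kind (for real parameter `m < 1`
the complex integral is real-valued). -/
def KR (m : ℝ) : ℝ := (ellK (m : ℂ)).re

/-- Classical real Jacobian elliptic function sn(x | m). -/
def snR (x m : ℝ) : ℝ := (sn (x : ℂ) (m : ℂ)).re

/-- Classical real Jacobian elliptic function cn(x | m). -/
def cnR (x m : ℝ) : ℝ := (cn (x : ℂ) (m : ℂ)).re

/-- Classical real Jacobian elliptic function dn(x | m). -/
def dnR (x m : ℝ) : ℝ := (dn (x : ℂ) (m : ℂ)).re

/-- φ(u, μ) = dc²(K(1-μ)u | 1-μ) − dc²(K(μ)u | μ) with real dc = dn/cn. -/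
def phi (u μ : ℝ) : ℝ :=
  (dnR (KR (1 - μ) * u) (1 - μ) / cnR (KR (1 - μ) * u) (1 - μ)) ^ 2 -
    (dnR (KR μ * u) μ / cnR (KR μ * u) μ) ^ 2

/-- The square of the continuously extended modulus |sn(K(m)u | m)|² for `m > 1`,
given by μ(s²d₁² + c²d²s₁²c₁²)/(1 − d²s₁²)² with μ = 1/m, μ₁ = 1 − μ. -/
def snAbsSq (u m : ℝ) : ℝ :=
  let μ := 1 / m
  let μ₁ := 1 - μ
  let s := snR (KR μ * u) μ
  let c := cnR (KR μ * u) μ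
  let d := dnR (KR μ * u) μ
  let s₁ := snR (KR μ₁ * u) μ₁
  let c₁ := cnR (KR μ₁ * u) μ₁
  let d₁ := dnR (KR μ₁ * u) μ₁
  μ * (s ^ 2 * d₁ ^ 2 + c ^ 2 * d ^ 2 * s₁ ^ 2 * c₁ ^ 2) / (1 - d ^ 2 * s₁ ^ 2) ^ 2

open Topology

/-- Bilateral θ₃ at nome `exp (-π t)`. -/
def A3t (z : ℂ) (t : ℝ) (n : ℤ) : ℂ :=
  Complex.exp (-(Real.pi : ℂ) * t * (n : ℂ) ^ 2 + 2 * n * z * I)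

/-- Bilateral θ₂ term at nome `exp (-π t)`. -/
def A2t (z : ℂ) (t : ℝ) (n : ℤ) : ℂ :=
  Complex.exp (-(Real.pi : ℂ) * t * ((n : ℂ) + 1 / 2) ^ 2 + (2 * n + 1) * z * I)

def A3 (z : ℂ) (t : ℝ) : ℂ := ∑' n : ℤ, A3t z t n
def A2 (z : ℂ) (t : ℝ) : ℂ := ∑' n : ℤ, A2t z t n

lemma pi_ne0C : (Real.pi : ℂ) ≠ 0 := by exact_mod_cast Real.pi_ne_zero

lemma A3t_eq (z : ℂ) (t : ℝ) (n : ℤ) : A3t z t n = jacobiTheta₂_term n (z / Real.pi) (t * I) := by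
  have := pi_ne0C
  unfold A3t jacobiTheta₂_term
  congr 1
  field_simp
  linear_combination (-(Real.pi : ℂ) * t * (n : ℂ) ^ 2) * I_sq

lemma A2t_eq (z : ℂ) (t : ℝ) (n : ℤ) : A2t z t n =
    Complex.exp (-(Real.pi : ℂ) * t / 4 + z * I) *
      jacobiTheta₂_term n (z / Real.pi + t * I / 2) (t * I) := by
  have := pi_ne0C
  unfold A2t jacobiTheta₂_term
  rw [← Complex.exp_add]
  congr 1
  field_simp
  linear_combination (-16 * (Real.pi : ℂ) * t * ((n : ℂ) ^ 2 + n)) * I_sq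

lemma im_tI (t : ℝ) : ((t : ℂ) * I).im = t := by simp

lemma A3_summable (z : ℂ) {t : ℝ} (ht : 0 < t) : Summable (A3t z t) := by
  have : A3t z t = fun n => jacobiTheta₂_term n (z / Real.pi) (t * I) := funext (A3t_eq z t)
  rw [this, summable_jacobiTheta₂_term_iff]; simpa using ht

lemma A2_summable (z : ℂ) {t : ℝ} (ht : 0 < t) : Summable (A2t z t) := by
  have : A2t z t = fun n => Complex.exp (-(Real.pi : ℂ) * t / 4 + z * I) *
      jacobiTheta₂_term n (z / Real.pi + t * I / 2) (t * I) := funext (A2t_eq z t)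
  rw [this]
  apply Summable.mul_left
  rw [summable_jacobiTheta₂_term_iff]; simpa using ht

lemma A3_eq (z : ℂ) (t : ℝ) : A3 z t = jacobiTheta₂ (z / Real.pi) (t * I) := by
  unfold A3 jacobiTheta₂; exact tsum_congr (A3t_eq z t)

lemma A2_eq (z : ℂ) (t : ℝ) : A2 z t = Complex.exp (-(Real.pi : ℂ) * t / 4 + z * I) *
    jacobiTheta₂ (z / Real.pi + t * I / 2) (t * I) := by
  unfold A2 jacobiTheta₂
  rw [← tsum_mul_left]
  exact tsum_congr (A2t_eq z t)

/-- parity splitting of the lattice -/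
def latEquiv : (ℤ × ℤ) ⊕ (ℤ × ℤ) ≃ ℤ × ℤ where
  toFun := Sum.elim (fun p => (p.1 + p.2, p.1 - p.2)) (fun p => (p.1 + p.2 + 1, p.1 - p.2))
  invFun := fun p => if (p.1 + p.2) % 2 = 0 then Sum.inl ((p.1 + p.2) / 2, (p.1 - p.2) / 2)
    else Sum.inr ((p.1 + p.2 - 1) / 2, (p.1 - p.2 - 1) / 2)
  left_inv := by
    rintro (⟨a, b⟩ | ⟨a, b⟩)
    · have : (a + b + (a - b)) % 2 = 0 := by omega
      simp only [Sum.elim_inl, this, if_true]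
      congr 2 <;> omega
    · have : ¬ (a + b + 1 + (a - b)) % 2 = 0 := by omega
      simp only [Sum.elim_inr, this, if_false]
      congr 2 <;> omega
  right_inv := by
    rintro ⟨a, b⟩
    by_cases h : (a + b) % 2 = 0
    · simp only [h, if_true, Sum.elim_inl]
      ext <;> simp <;> omega
    · simp only [h, if_false, Sum.elim_inr]
      ext <;> simp <;> omega

lemma lat_split {f : ℤ × ℤ → ℂ} (hf : Summable f) :
    ∑' p, f p = (∑' p : ℤ × ℤ, f (p.1 + p.2, p.1 - p.2)) +
      ∑' p : ℤ × ℤ, f (p.1 + p.2 + 1, p.1 - p.2) := by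
  rw [← latEquiv.tsum_eq f]
  have hs : Summable (fun x => f (latEquiv x)) := (latEquiv.summable_iff (f := f)).mpr hf
  rw [Summable.tsum_sum (f := fun x => f (latEquiv x))]
  · rfl
  · exact hs.comp_injective Sum.inl_injective
  · exact hs.comp_injective Sum.inr_injective

lemma prod_split {f g : ℤ → ℂ} {f1 g1 f2 g2 : ℤ → ℂ} (hf : Summable f) (hg : Summable g)
    (hf1 : Summable f1) (hg1 : Summable g1) (hf2 : Summable f2) (hg2 : Summable g2)
    (h1 : ∀ a b, f (a + b) * g (a - b) = f1 a * g1 b)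
    (h2 : ∀ a b, f (a + b + 1) * g (a - b) = f2 a * g2 b) :
    (∑' n, f n) * (∑' n, g n) = (∑' n, f1 n) * (∑' n, g1 n) + (∑' n, f2 n) * (∑' n, g2 n) := by
  rw [tsum_mul_tsum_of_summable_norm hf.norm hg.norm,
    tsum_mul_tsum_of_summable_norm hf1.norm hg1.norm,
    tsum_mul_tsum_of_summable_norm hf2.norm hg2.norm]
  rw [lat_split (f := fun x => f x.1 * g x.2) (summable_mul_of_summable_norm hf.norm hg.norm)]
  simp only [h1, h2]

lemma A3_mul (x y : ℂ) {t : ℝ} (ht : 0 < t) :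
    A3 x t * A3 y t = A3 (x + y) (2 * t) * A3 (x - y) (2 * t) +
      A2 (x + y) (2 * t) * A2 (x - y) (2 * t) := by
  have ht2 : 0 < 2 * t := by positivity
  apply prod_split (A3_summable _ ht) (A3_summable _ ht) (A3_summable _ ht2) (A3_summable _ ht2)
    (A2_summable _ ht2) (A2_summable _ ht2)
  · intro a b
    unfold A3t
    rw [← Complex.exp_add, ← Complex.exp_add]
    congr 1; push_cast; ring
  · intro a b
    unfold A3t A2t
    rw [← Complex.exp_add, ← Complex.exp_add]
    congr 1; push_cast; ring

lemma A2_mul (x y : ℂ) {t : ℝ} (ht : 0 < t) :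
    A2 x t * A2 y t = A2 (x + y) (2 * t) * A3 (x - y) (2 * t) +
      A3 (x + y) (2 * t) * A2 (x - y) (2 * t) := by
  have ht2 : 0 < 2 * t := by positivity
  have e : A3 (x + y) (2 * t) = ∑' n, A3t (x + y) (2 * t) (n + 1) :=
    ((Equiv.addRight (1 : ℤ)).tsum_eq (A3t (x + y) (2 * t))).symm
  rw [e]
  apply prod_split (A2_summable _ ht) (A2_summable _ ht) (A2_summable _ ht2) (A3_summable _ ht2)
    ((Equiv.addRight (1 : ℤ)).summable_iff.mpr (A3_summable (x + y) ht2)) (A2_summable _ ht2)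
  · intro a b
    unfold A3t A2t
    rw [← Complex.exp_add, ← Complex.exp_add]
    congr 1; push_cast; ring
  · intro a b
    unfold A3t A2t
    simp only [Function.comp, Equiv.coe_addRight]
    rw [← Complex.exp_add, ← Complex.exp_add]
    congr 1; push_cast; ring

lemma A3_add_pi (z : ℂ) (t : ℝ) : A3 (z + Real.pi) t = A3 z t := by
  rw [A3_eq, A3_eq, add_div, div_self pi_ne0C, jacobiTheta₂_add_left]

lemma A2_add_pi (z : ℂ) (t : ℝ) : A2 (z + Real.pi) t = - A2 z t := by
  rw [A2_eq, A2_eq, add_div, div_self pi_ne0C]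
  rw [show z / (Real.pi : ℂ) + 1 + t * I / 2 = (z / (Real.pi : ℂ) + t * I / 2) + 1 by ring,
    jacobiTheta₂_add_left, show -(Real.pi : ℂ) * t / 4 + (z + Real.pi) * I =
      (-(Real.pi : ℂ) * t / 4 + z * I) + Real.pi * I by ring, Complex.exp_add, Complex.exp_pi_mul_I]
  ring

lemma A3_neg (z : ℂ) (t : ℝ) : A3 (-z) t = A3 z t := by
  rw [A3_eq, A3_eq, neg_div, jacobiTheta₂_neg_left]

lemma A2_neg (z : ℂ) (t : ℝ) : A2 (-z) t = A2 z t := by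
  unfold A2
  rw [← (Equiv.subLeft (-1 : ℤ)).tsum_eq (A2t z t)]
  refine tsum_congr fun n => ?_
  unfold A2t
  congr 1
  simp only [Equiv.subLeft_apply]; push_cast; ring

/-- θ₄ and θ₁ -/
def A4 (z : ℂ) (t : ℝ) : ℂ := A3 (z - Real.pi / 2) t
def A1 (z : ℂ) (t : ℝ) : ℂ := A2 (z - Real.pi / 2) t

lemma A3_sq (z : ℂ) {t : ℝ} (ht : 0 < t) : A3 z t ^ 2 =
    A3 0 (2 * t) * A3 (2 * z) (2 * t) + A2 0 (2 * t) * A2 (2 * z) (2 * t) := by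
  rw [sq, A3_mul z z ht, sub_self, two_mul z]; ring

lemma A2_sq (z : ℂ) {t : ℝ} (ht : 0 < t) : A2 z t ^ 2 =
    A2 0 (2 * t) * A3 (2 * z) (2 * t) + A3 0 (2 * t) * A2 (2 * z) (2 * t) := by
  rw [sq, A2_mul z z ht, sub_self, two_mul z]; ring

lemma A4_sq (z : ℂ) {t : ℝ} (ht : 0 < t) : A4 z t ^ 2 =
    A3 0 (2 * t) * A3 (2 * z) (2 * t) - A2 0 (2 * t) * A2 (2 * z) (2 * t) := by
  have h3 := A3_add_pi (2 * (z - Real.pi / 2)) (2 * t)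
  have h2 := A2_add_pi (2 * (z - Real.pi / 2)) (2 * t)
  rw [show 2 * (z - (Real.pi : ℂ) / 2) + Real.pi = 2 * z by ring] at h2 h3
  rw [A4, A3_sq _ ht, h2, h3]; ring

lemma A1_sq (z : ℂ) {t : ℝ} (ht : 0 < t) : A1 z t ^ 2 =
    A2 0 (2 * t) * A3 (2 * z) (2 * t) - A3 0 (2 * t) * A2 (2 * z) (2 * t) := by
  have h3 := A3_add_pi (2 * (z - Real.pi / 2)) (2 * t)
  have h2 := A2_add_pi (2 * (z - Real.pi / 2)) (2 * t)
  rw [show 2 * (z - (Real.pi : ℂ) / 2) + Real.pi = 2 * z by ring] at h2 h3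
  rw [A1, A2_sq _ ht, h2, h3]; ring

lemma theta_id1 (z : ℂ) {t : ℝ} (ht : 0 < t) :
    A2 0 t ^ 2 * A4 z t ^ 2 = A3 0 t ^ 2 * A1 z t ^ 2 + A4 0 t ^ 2 * A2 z t ^ 2 := by
  simp only [A1_sq _ ht, A2_sq _ ht, A3_sq _ ht, A4_sq _ ht, mul_zero]; ring

lemma theta_id2 (z : ℂ) {t : ℝ} (ht : 0 < t) :
    A3 0 t ^ 2 * A4 z t ^ 2 = A2 0 t ^ 2 * A1 z t ^ 2 + A4 0 t ^ 2 * A3 z t ^ 2 := by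
  simp only [A1_sq _ ht, A2_sq _ ht, A3_sq _ ht, A4_sq _ ht, mul_zero]; ring

lemma theta_id0 {t : ℝ} (ht : 0 < t) : A3 0 t ^ 4 = A2 0 t ^ 4 + A4 0 t ^ 4 := by
  have e3 := A3_sq 0 ht
  have e2 := A2_sq 0 ht
  have e4 := A4_sq 0 ht
  rw [mul_zero] at e2 e3 e4
  rw [show A3 0 t ^ 4 = (A3 0 t ^ 2) ^ 2 by ring, show A2 0 t ^ 4 = (A2 0 t ^ 2) ^ 2 by ring,
    show A4 0 t ^ 4 = (A4 0 t ^ 2) ^ 2 by ring, e3, e2, e4]; ring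

lemma A2_landen (z : ℂ) {t : ℝ} (ht : 0 < t) :
    A2 z t * A2 0 t = 2 * (A2 z (2 * t) * A3 z (2 * t)) := by
  rw [A2_mul z 0 ht, add_zero, sub_zero]; ring
lemma A3_imag (a : ℝ) {t : ℝ} (ht : 0 < t) : ∃ r : ℝ, 0 < r ∧ A3 (a * I) t = r := by
  have e : ∀ n, A3t (a * I) t n = ((Real.exp (-Real.pi * t * n ^ 2 - 2 * n * a) : ℝ) : ℂ) := by
    intro n
    unfold A3t
    push_cast
    congr 1
    linear_combination (2 * (n : ℂ) * a) * I_sq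
  have hs := A3_summable (a * I) ht
  rw [funext e] at hs
  have hs' := Complex.summable_ofReal.mp hs
  refine ⟨_, hs'.tsum_pos (fun _ => (Real.exp_pos _).le) 0 (Real.exp_pos _), ?_⟩
  unfold A3
  rw [Complex.ofReal_tsum]
  exact tsum_congr e

lemma A2_zero_real {t : ℝ} (ht : 0 < t) : ∃ r : ℝ, 0 < r ∧ A2 0 t = r := by
  obtain ⟨r, hr, h⟩ := A3_imag (Real.pi * t / 2) ht
  refine ⟨Real.exp (-Real.pi * t / 4) * r, by positivity, ?_⟩
  have := pi_ne0C
  rw [A2_eq]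
  push_cast
  rw [← h, A3_eq]
  push_cast
  rw [show (0 : ℂ) / Real.pi + t * I / 2 = Real.pi * t / 2 * I / Real.pi by field_simp; simp]
  simp

lemma sqrt_cpow {t : ℝ} (ht : 0 < t) : (-I * ((t : ℂ) * I)) ^ (1 / 2 : ℂ) = (√t : ℝ) := by
  rw [show -I * ((t : ℂ) * I) = (t : ℂ) by linear_combination (-(t : ℂ)) * I_sq]
  rw [Real.sqrt_eq_rpow, Complex.ofReal_cpow ht.le]
  norm_num

lemma A3_inv (x : ℂ) {t : ℝ} (ht : 0 < t) :
    A3 x t = 1 / (√t : ℝ) * Complex.exp (-x ^ 2 / (Real.pi * t)) * A3 (x / t * I) (1 / t) := by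
  have := pi_ne0C
  have ht0 : (t : ℂ) ≠ 0 := by exact_mod_cast ht.ne'
  rw [A3_eq, A3_eq, jacobiTheta₂_functional_equation, sqrt_cpow ht]
  rw [show x / (Real.pi : ℂ) / (t * I) = - (x / t * I / Real.pi) by
    field_simp; linear_combination x * I_sq, jacobiTheta₂_neg_left,
    show -1 / ((t : ℂ) * I) = ((1 / t : ℝ) : ℂ) * I by
      push_cast; field_simp; linear_combination -I_sq]
  congr 3
  field_simp

lemma A3_real_pos (x : ℝ) {t : ℝ} (ht : 0 < t) : ∃ r : ℝ, 0 < r ∧ A3 x t = r := by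
  obtain ⟨r, hr, h⟩ := A3_imag (x / t) (t := 1 / t) (by positivity)
  refine ⟨1 / √t * Real.exp (-x ^ 2 / (Real.pi * t)) * r, by positivity, ?_⟩
  push_cast at h
  rw [A3_inv _ ht]
  push_cast
  rw [← h]

lemma A4_real_pos (x : ℝ) {t : ℝ} (ht : 0 < t) : ∃ r : ℝ, 0 < r ∧ A4 x t = r := by
  have := A3_real_pos (x - Real.pi / 2) ht
  unfold A4
  push_cast at this
  exact this

lemma A2_real (x : ℝ) (t : ℝ) : ∃ r : ℝ, A2 x t = r := by
  rw [← Complex.conj_eq_iff_real]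
  conv_rhs => rw [← A2_neg]
  unfold A2
  rw [Complex.conj_tsum]
  refine tsum_congr fun n => ?_
  unfold A2t
  rw [← Complex.exp_conj]
  congr 1
  simp [Complex.conj_ofNat]

lemma A1_real (x : ℝ) (t : ℝ) : ∃ r : ℝ, A1 x t = r := by
  have := A2_real (x - Real.pi / 2) t
  unfold A1
  push_cast at this
  exact this

lemma A3_zero_inv {t : ℝ} (ht : 0 < t) : A3 0 (1 / t) = (√t : ℝ) * A3 0 t := by
  have h := A3_inv 0 ht
  have : ((√t : ℝ) : ℂ) ≠ 0 := by exact_mod_cast (Real.sqrt_pos.mpr ht).ne'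
  rw [h]
  simp
  field_simp

lemma A2_zero_inv {t : ℝ} (ht : 0 < t) : A2 0 (1 / t) = (√t : ℝ) * A4 0 t := by
  have hpi := pi_ne0C
  have ht0 : (t : ℂ) ≠ 0 := by exact_mod_cast ht.ne'
  have : ((√t : ℝ) : ℂ) ≠ 0 := by exact_mod_cast (Real.sqrt_pos.mpr ht).ne'
  unfold A4
  rw [zero_sub, A3_neg, A3_inv _ ht, A2_eq, A3_eq]
  have e : (0 : ℂ) / Real.pi + ((1 / t : ℝ) : ℂ) * I / 2 = (Real.pi : ℂ) / 2 / t * I / Real.pi := by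
    push_cast; field_simp; simp
  rw [e]
  have e2 : -(Real.pi : ℂ) * ((1 / t : ℝ) : ℂ) / 4 + 0 * I = -((Real.pi : ℂ) / 2) ^ 2 / (Real.pi * t) := by
    push_cast; field_simp; ring
  rw [e2]
  field_simp

lemma tendsto_exp_neg_mul {c : ℝ} (hc : 0 < c) (w : ℂ) :
    Tendsto (fun t : ℝ => Complex.exp (-((c * t : ℝ) : ℂ) + w)) atTop (𝓝 0) := by
  rw [tendsto_zero_iff_norm_tendsto_zero]
  have : ∀ t : ℝ, ‖Complex.exp (-((c * t : ℝ) : ℂ) + w)‖ = Real.exp (-(c * t)) * Real.exp w.re := by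
    intro t
    rw [Complex.norm_exp, ← Real.exp_add]
    simp
  simp only [this]
  have h1 : Tendsto (fun t : ℝ => Real.exp (-(c * t))) atTop (𝓝 0) :=
    Real.tendsto_exp_neg_atTop_nhds_zero.comp (tendsto_id.const_mul_atTop hc)
  simpa using h1.mul_const (Real.exp w.re)

lemma A3_tendsto : Tendsto (fun t : ℝ => A3 0 t) atTop (𝓝 1) := by
  have h : Tendsto (fun t : ℝ => ∑' n : ℤ, A3t 0 t n) atTop
      (𝓝 (∑' n : ℤ, if n = 0 then (1 : ℂ) else 0)) := by
    apply tendsto_tsum_of_dominated_convergence (bound := fun n => ‖A3t 0 1 n‖)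
    · exact (A3_summable 0 one_pos).norm
    · intro n
      by_cases hn : n = 0
      · subst hn
        simp [A3t]
      · simp only [hn, if_false]
        have hn2 : 0 < Real.pi * (n : ℝ) ^ 2 := by
          have : (n : ℝ) ≠ 0 := by exact_mod_cast hn
          have := Real.pi_pos
          positivity
        refine (tendsto_exp_neg_mul hn2 0).congr fun t => ?_
        unfold A3t
        congr 1
        push_cast; ring
    · filter_upwards [eventually_ge_atTop 1] with t ht n
      unfold A3t
      rw [Complex.norm_exp, Complex.norm_exp]
      apply Real.exp_le_exp.mpr
      have e : ∀ s : ℝ, (-(Real.pi : ℂ) * s * (n : ℂ) ^ 2 + 2 * n * 0 * I).re = -(Real.pi * n ^ 2) * s := by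
        intro s
        rw [show (-(Real.pi : ℂ) * s * (n : ℂ) ^ 2 + 2 * n * 0 * I) = ((-(Real.pi * n ^ 2) * s : ℝ) : ℂ) by
          push_cast; ring, Complex.ofReal_re]
      rw [e, e]
      have : 0 ≤ Real.pi * (n : ℝ) ^ 2 := by have := Real.pi_pos; positivity
      nlinarith
  simpa [A3] using h

lemma A2_tendsto (x : ℝ) : Tendsto (fun t : ℝ => Complex.exp ((Real.pi / 4 * t : ℝ) : ℂ) * A2 x t)
    atTop (𝓝 (2 * Complex.cos x)) := by
  have h : Tendsto (fun t : ℝ => ∑' n : ℤ, Complex.exp ((Real.pi / 4 * t : ℝ) : ℂ) * A2t x t n) atTop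
      (𝓝 (∑' n : ℤ, if n = 0 ∨ n = -1 then Complex.exp ((2 * n + 1) * x * I) else 0)) := by
    have ef : ∀ (t : ℝ) (n : ℤ), Complex.exp ((Real.pi / 4 * t : ℝ) : ℂ) * A2t x t n =
        Complex.exp (-((Real.pi * ((n ^ 2 + n : ℤ) : ℝ) * t : ℝ) : ℂ) + (2 * n + 1) * x * I) := by
      intro t n
      unfold A2t
      rw [← Complex.exp_add]
      congr 1
      push_cast; ring
    have en : ∀ (t : ℝ) (n : ℤ), ‖Complex.exp ((Real.pi / 4 * t : ℝ) : ℂ) * A2t x t n‖ =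
        Real.exp (-(Real.pi * ((n ^ 2 + n : ℤ) : ℝ) * t)) := by
      intro t n
      rw [ef, Complex.norm_exp]
      congr 1
      rw [Complex.add_re, show (2 * (n : ℂ) + 1) * x * I = (((2 * n + 1) * x : ℝ) : ℂ) * I by
        push_cast; ring, ← Complex.ofReal_neg, Complex.ofReal_re]
      simp
    apply tendsto_tsum_of_dominated_convergence
      (bound := fun n => ‖Complex.exp ((Real.pi / 4 * (1 : ℝ) : ℝ) : ℂ) * A2t x 1 n‖)
    · exact ((A2_summable x one_pos).mul_left _).norm
    · intro n
      simp only [ef]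
      by_cases hn : n = 0 ∨ n = -1
      · simp only [hn, if_true]
        have : n ^ 2 + n = 0 := by rcases hn with rfl | rfl <;> norm_num
        simp [this]
      · simp only [hn, if_false]
        push Not at hn
        have hn1 : 0 < n ^ 2 + n := by
          rcases lt_or_gt_of_ne hn.1 with h | h
          · have : n ≤ -2 := by have := hn.2; omega
            nlinarith
          · nlinarith
        apply tendsto_exp_neg_mul
        have : (0 : ℝ) < ((n ^ 2 + n : ℤ) : ℝ) := by exact_mod_cast hn1
        have := Real.pi_pos
        positivity
    · filter_upwards [eventually_ge_atTop 1] with t ht n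
      rw [en, en]
      apply Real.exp_le_exp.mpr
      have hn1 : 0 ≤ n ^ 2 + n := by
        rcases le_or_gt 0 n with h | h
        · positivity
        · nlinarith
      have : (0 : ℝ) ≤ ((n ^ 2 + n : ℤ) : ℝ) := by exact_mod_cast hn1
      have : 0 ≤ Real.pi * ((n ^ 2 + n : ℤ) : ℝ) := by have := Real.pi_pos; positivity
      nlinarith
  simp only [tsum_mul_left] at h
  have key : (∑' n : ℤ, if n = 0 ∨ n = -1 then Complex.exp ((2 * n + 1) * x * I) else 0) =
      2 * Complex.cos x := by
    rw [tsum_eq_sum (s := {0, -1})]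
    · rw [Finset.sum_insert (by decide), Finset.sum_singleton]
      simp [Complex.cos]
      ring_nf
    · intro n hn
      simp at hn
      simp [hn]
  rw [key] at h
  exact h

lemma A2_ne_zero {x : ℝ} (hx0 : 0 < x) (hx1 : x < Real.pi / 2) {t : ℝ} (ht : 0 < t) :
    A2 x t ≠ 0 := by
  intro h0
  have step : ∀ s : ℝ, 0 < s → A2 x s = 0 → A2 x (2 * s) = 0 := by
    intro s hs h
    have := A2_landen x hs
    rw [h, zero_mul] at this
    obtain ⟨r, hr, hr'⟩ := A3_real_pos x (t := 2 * s) (by positivity)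
    rw [hr'] at this
    have : (r : ℂ) ≠ 0 := by exact_mod_cast hr.ne'
    simp_all
  have all : ∀ n : ℕ, A2 x (2 ^ n * t) = 0 := by
    intro n
    induction n with
    | zero => simpa using h0
    | succ k ih =>
      have := step _ (by positivity) ih
      rw [pow_succ, show (2 : ℝ) ^ k * 2 * t = 2 * (2 ^ k * t) by ring]
      exact this
  have hT : Tendsto (fun n : ℕ => (2 : ℝ) ^ n * t) atTop atTop :=
    (tendsto_pow_atTop_atTop_of_one_lt one_lt_two).atTop_mul_const ht
  have h := (A2_tendsto x).comp hT
  simp only [Function.comp_def, all, mul_zero] at h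
  have := tendsto_nhds_unique h tendsto_const_nhds
  have hc : 0 < Real.cos x := Real.cos_pos_of_mem_Ioo ⟨by linarith [Real.pi_pos], hx1⟩
  rw [← Complex.ofReal_cos] at this
  have h2 : (2 * Real.cos x : ℝ) = 0 := by exact_mod_cast this
  linarith
lemma q_cpow (t : ℝ) (w : ℂ) :
    (Complex.exp (-(Real.pi : ℂ) * t)) ^ w = Complex.exp (-(Real.pi : ℂ) * t * w) := by
  rw [Complex.cpow_def_of_ne_zero (Complex.exp_ne_zero _)]
  congr 2
  rw [show -(Real.pi : ℂ) * t = ((-Real.pi * t : ℝ) : ℂ) by push_cast; ring]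
  rw [← Complex.ofReal_exp, ← Complex.ofReal_log (Real.exp_pos _).le, Real.log_exp]

lemma theta2_eq (z : ℂ) {t : ℝ} (ht : 0 < t) :
    theta2 z (Complex.exp (-(Real.pi : ℂ) * t)) = A2 z t := by
  have hs := A2_summable z ht
  have h1 : Summable (fun n : ℕ => A2t z t n) := hs.comp_injective Nat.cast_injective
  have h2 : Summable (fun n : ℕ => A2t z t (-(n + 1 : ℤ))) :=
    hs.comp_injective (i := fun n : ℕ => (-(n + 1 : ℤ))) (fun a b h => by simpa using h)
  unfold A2 theta2
  rw [tsum_of_nat_of_neg_add_one h1 h2, ← h1.tsum_add h2, ← tsum_mul_left]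
  refine tsum_congr fun n => ?_
  rw [q_cpow, Complex.cos]
  unfold A2t
  rw [Complex.exp_add, Complex.exp_add]
  push_cast
  rw [show (-((n : ℂ) + 1) + 1 / 2) ^ 2 = ((n : ℂ) + 1 / 2) ^ 2 by ring,
    show (2 * -((n : ℂ) + 1) + 1) * z * I = -((2 * (n : ℂ) + 1) * z) * I by ring]
  ring

lemma theta3_eq (z : ℂ) {t : ℝ} (ht : 0 < t) :
    theta3 z (Complex.exp (-(Real.pi : ℂ) * t)) = A3 z t := by
  have hs := A3_summable z ht
  have h1 : Summable (fun n : ℕ => A3t z t n) := hs.comp_injective Nat.cast_injective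
  have h2 : Summable (fun n : ℕ => A3t z t (-(n + 1 : ℤ))) :=
    hs.comp_injective (i := fun n : ℕ => (-(n + 1 : ℤ))) (fun a b h => by simpa using h)
  have h3 : Summable (fun n : ℕ => A3t z t ((n + 1 : ℕ) : ℤ)) := (summable_nat_add_iff 1).mpr h1
  unfold A3 theta3
  rw [tsum_of_nat_of_neg_add_one h1 h2, h1.tsum_eq_zero_add, add_assoc, ← h3.tsum_add h2,
    ← tsum_mul_left]
  congr 1
  · simp [A3t]
  refine tsum_congr fun n => ?_
  rw [← Complex.exp_nat_mul, Complex.cos]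
  unfold A3t
  rw [Complex.exp_add, Complex.exp_add]
  push_cast
  rw [show (-((n : ℂ) + 1)) ^ 2 = ((n : ℂ) + 1) ^ 2 by ring,
    show 2 * -((n : ℂ) + 1) * z * I = -(2 * ((n : ℂ) + 1) * z) * I by ring,
    mul_comm (((n : ℂ) + 1) ^ 2)]
  ring

lemma theta4_eq (z : ℂ) {t : ℝ} (ht : 0 < t) :
    theta4 z (Complex.exp (-(Real.pi : ℂ) * t)) = A4 z t := by
  rw [A4, ← theta3_eq _ ht]
  unfold theta3 theta4
  congr 2
  refine tsum_congr fun n => ?_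
  rw [show 2 * ((n : ℂ) + 1) * (z - Real.pi / 2) =
    2 * ((n : ℂ) + 1) * z - ((n + 1 : ℕ) : ℂ) * Real.pi by push_cast; ring,
    Complex.cos_antiperiodic.sub_nat_mul_eq]
  ring

lemma theta1_eq (z : ℂ) {t : ℝ} (ht : 0 < t) :
    theta1 z (Complex.exp (-(Real.pi : ℂ) * t)) = A1 z t := by
  rw [A1, ← theta2_eq _ ht]
  unfold theta1 theta2
  congr 1
  refine tsum_congr fun n => ?_
  rw [show (2 * (n : ℂ) + 1) * (z - Real.pi / 2) =
    ((2 * (n : ℂ) + 1) * z - Real.pi / 2) - (n : ℂ) * Real.pi by ring,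
    Complex.cos_antiperiodic.sub_nat_mul_eq, Complex.cos_sub_pi_div_two]
  ring
open MeasureTheory in
/-- real integrand -/
def kint (m t : ℝ) : ℝ := 1 / √((1 - t ^ 2) * (1 - m * t ^ 2))

open MeasureTheory in
/-- real complete elliptic integral -/
def Kre (m : ℝ) : ℝ := ∫ t in Ioo (0 : ℝ) 1, kint m t

open MeasureTheory in
lemma ellK_eq {m : ℝ} (hm : m < 1) : ellK (m : ℂ) = (Kre m : ℂ) := by
  unfold ellK Kre
  rw [intervalIntegral.integral_of_le zero_le_one, integral_Ioc_eq_integral_Ioo,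
    ← integral_complex_ofReal]
  refine setIntegral_congr_fun measurableSet_Ioo fun t ht => ?_
  simp only [kint]
  have h1 : 0 ≤ (1 - t ^ 2) * (1 - m * t ^ 2) := by
    have : t ^ 2 < 1 := by nlinarith [ht.1, ht.2]
    have : m * t ^ 2 < 1 := by nlinarith [sq_nonneg t, ht.1]
    apply mul_nonneg <;> linarith
  rw [Real.sqrt_eq_rpow]
  push_cast
  rw [Complex.ofReal_cpow h1]
  push_cast
  rfl

open MeasureTheory in
lemma kint_zero_integrable : IntegrableOn (kint 0) (Ioo 0 1) := by
  have h : IntegrableOn (fun t => 1 / √(1 - t ^ 2)) (Ioc (0 : ℝ) 1) := by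
    apply intervalIntegral.integrableOn_deriv_of_nonneg (g := Real.arcsin)
    · exact Real.continuous_arcsin.continuousOn
    · intro x hx
      exact Real.hasDerivAt_arcsin (by linarith [hx.1]) (by linarith [hx.2])
    · intro x hx; positivity
  refine (h.mono_set Ioo_subset_Ioc_self).congr_fun (fun t ht => ?_) measurableSet_Ioo
  simp [kint]

lemma kint_meas (m : ℝ) : Measurable (kint m) := by
  unfold kint; fun_prop

lemma kint_bounds {m t : ℝ} (hm0 : 0 ≤ m) (hm : m < 1) (ht : t ∈ Ioo (0 : ℝ) 1) :
    kint 0 t ≤ kint m t ∧ kint m t ≤ 1 / √(1 - m) * kint 0 t := by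
  have h1 : 0 < 1 - t ^ 2 := by nlinarith [ht.1, ht.2]
  have h2 : 1 - m ≤ 1 - m * t ^ 2 := by nlinarith [ht.1, ht.2]
  have h3 : 1 - m * t ^ 2 ≤ 1 := by nlinarith [sq_nonneg t]
  have h4 : 0 < 1 - m := by linarith
  unfold kint
  constructor
  · apply one_div_le_one_div_of_le
    · apply Real.sqrt_pos.mpr; apply mul_pos <;> linarith
    · apply Real.sqrt_le_sqrt; nlinarith
  · rw [one_div_mul_one_div]
    rw [← Real.sqrt_mul h4.le]
    apply one_div_le_one_div_of_le
    · apply Real.sqrt_pos.mpr; apply mul_pos h4; nlinarith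
    · apply Real.sqrt_le_sqrt; nlinarith

lemma kint_nonneg (m t : ℝ) : 0 ≤ kint m t := by unfold kint; positivity

open MeasureTheory in
lemma kint_integrable {m : ℝ} (hm0 : 0 ≤ m) (hm : m < 1) : IntegrableOn (kint m) (Ioo 0 1) := by
  refine Integrable.mono' (kint_zero_integrable.const_mul (1 / √(1 - m)))
    (kint_meas m).aestronglyMeasurable ?_
  refine (ae_restrict_iff' measurableSet_Ioo).mpr (ae_of_all _ fun t ht => ?_)
  rw [Real.norm_of_nonneg (kint_nonneg _ _)]
  exact (kint_bounds hm0 hm ht).2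

open MeasureTheory in
lemma Kre_bounds {m : ℝ} (hm0 : 0 ≤ m) (hm : m < 1) :
    Kre 0 ≤ Kre m ∧ Kre m ≤ 1 / √(1 - m) * Kre 0 := by
  unfold Kre
  constructor
  · exact setIntegral_mono_on kint_zero_integrable (kint_integrable hm0 hm) measurableSet_Ioo
      fun t ht => (kint_bounds hm0 hm ht).1
  · rw [← integral_const_mul]
    exact setIntegral_mono_on (kint_integrable hm0 hm) (kint_zero_integrable.const_mul _)
      measurableSet_Ioo fun t ht => (kint_bounds hm0 hm ht).2

open MeasureTheory in
lemma Kre_zero_pos : 0 < Kre 0 := by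
  have h : ∫ t in Ioo (0 : ℝ) 1, (1 : ℝ) ≤ Kre 0 := by
    unfold Kre
    refine setIntegral_mono_on (by simp) kint_zero_integrable measurableSet_Ioo fun t ht => ?_
    unfold kint
    have h1 : 0 < 1 - t ^ 2 := by nlinarith [ht.1, ht.2]
    rw [le_div_iff₀ (Real.sqrt_pos.mpr (by simpa using h1))]
    rw [one_mul]
    apply Real.sqrt_le_one.mpr
    nlinarith [sq_nonneg t]
  simp at h
  linarith

lemma Kre_pos {m : ℝ} (hm0 : 0 ≤ m) (hm : m < 1) : 0 < Kre m :=
  lt_of_lt_of_le Kre_zero_pos (Kre_bounds hm0 hm).1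

open MeasureTheory in
/-- ascending Landen transformation -/
lemma Kre_landen {a : ℝ} (ha0 : 0 < a) (ha : a < 1) :
    Kre ((2 * √a / (1 + a)) ^ 2) = (1 + a) * Kre (a ^ 2) := by
  have hk : (2 * √a / (1 + a)) ^ 2 = 4 * a / (1 + a) ^ 2 := by
    rw [div_pow, mul_pow, Real.sq_sqrt ha0.le]; norm_num
  rw [hk]
  set f : ℝ → ℝ := fun t => (1 + a) * t / (1 + a * t ^ 2) with hf
  set f' : ℝ → ℝ := fun t => (1 + a) * (1 - a * t ^ 2) / (1 + a * t ^ 2) ^ 2 with hf'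
  have hpos : ∀ t : ℝ, 0 < 1 + a * t ^ 2 := fun t => by positivity
  have hd : ∀ t : ℝ, HasDerivAt f (f' t) t := by
    intro t
    have h1 : HasDerivAt (fun t : ℝ => (1 + a) * t) (1 + a) t := by
      simpa using (hasDerivAt_id t).const_mul (1 + a)
    have h2 : HasDerivAt (fun t : ℝ => 1 + a * t ^ 2) (a * (2 * t)) t := by
      simpa using ((hasDerivAt_pow 2 t).const_mul a).const_add 1
    refine (h1.div h2 (hpos t).ne').congr_deriv ?_
    simp only [hf']
    congr 1
    ring
  have hcont : Continuous f := continuous_iff_continuousAt.mpr fun t => (hd t).continuousAt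
  have hmono : StrictMonoOn f (Icc 0 1) := by
    apply strictMonoOn_of_deriv_pos (convex_Icc 0 1) hcont.continuousOn
    intro t ht
    rw [interior_Icc] at ht
    rw [(hd t).deriv]
    have : 0 < 1 - a * t ^ 2 := by nlinarith [ht.1, ht.2]
    have := hpos t
    positivity
  have f0 : f 0 = 0 := by simp [hf]
  have f1 : f 1 = 1 := by
    have : 1 + a ≠ 0 := by positivity
    simp [hf, this]
  have himg : f '' Ioo 0 1 = Ioo 0 1 := by
    apply Subset.antisymm
    · rintro _ ⟨t, ht, rfl⟩
      constructor
      · rw [← f0]; exact hmono (by simp) ⟨ht.1.le, ht.2.le⟩ ht.1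
      · rw [← f1]; exact hmono ⟨ht.1.le, ht.2.le⟩ (by simp) ht.2
    · have := intermediate_value_Ioo (zero_le_one' ℝ) hcont.continuousOn
      rwa [f0, f1] at this
  unfold Kre
  rw [← integral_const_mul]
  conv_lhs => rw [← himg]
  rw [integral_image_eq_integral_abs_deriv_smul measurableSet_Ioo
    (fun x _ => (hd x).hasDerivWithinAt) (hmono.injOn.mono Ioo_subset_Icc_self)]
  refine setIntegral_congr_fun measurableSet_Ioo fun t ht => ?_
  have hp := hpos t
  have h1 : 0 < 1 - a * t ^ 2 := by nlinarith [ht.1, ht.2]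
  have h2 : 0 < 1 - t ^ 2 := by nlinarith [ht.1, ht.2]
  have h3 : 0 < 1 - a ^ 2 * t ^ 2 := by nlinarith [mul_pos ha0 ha0, ht.1]
  have e : (1 - f t ^ 2) * (1 - 4 * a / (1 + a) ^ 2 * f t ^ 2) =
      ((1 - t ^ 2) * (1 - a ^ 2 * t ^ 2)) * ((1 - a * t ^ 2) / (1 + a * t ^ 2) ^ 2) ^ 2 := by
    simp only [hf]
    have : 1 + a ≠ 0 := by positivity
    field_simp
    ring
  have hf'pos : 0 < f' t := by simp only [hf']; positivity
  simp only [smul_eq_mul, kint]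
  rw [e, abs_of_pos hf'pos, Real.sqrt_mul (by positivity), Real.sqrt_sq (by positivity)]
  have : √((1 - t ^ 2) * (1 - a ^ 2 * t ^ 2)) ≠ 0 := (Real.sqrt_pos.mpr (by positivity)).ne'
  simp only [hf']
  field_simp
def r2 (t : ℝ) : ℝ := (A2 0 t).re
def r3 (t : ℝ) : ℝ := (A3 0 t).re
def r4 (t : ℝ) : ℝ := (A4 0 t).re

lemma r2_spec {t : ℝ} (ht : 0 < t) : 0 < r2 t ∧ A2 0 t = r2 t := by
  obtain ⟨r, hr, h⟩ := A2_zero_real ht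
  simp [r2, h, hr]

lemma r3_spec {t : ℝ} (ht : 0 < t) : 0 < r3 t ∧ A3 0 t = r3 t := by
  obtain ⟨r, hr, h⟩ := A3_real_pos 0 ht
  rw [Complex.ofReal_zero] at h
  simp [r3, h, hr]

lemma r4_spec {t : ℝ} (ht : 0 < t) : 0 < r4 t ∧ A4 0 t = r4 t := by
  obtain ⟨r, hr, h⟩ := A4_real_pos 0 ht
  rw [Complex.ofReal_zero] at h
  simp [r4, h, hr]

lemma r3_sq {t : ℝ} (ht : 0 < t) : r3 t ^ 2 = r3 (2 * t) ^ 2 + r2 (2 * t) ^ 2 := by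
  have h := A3_sq 0 ht
  rw [mul_zero, (r3_spec ht).2, (r3_spec (t := 2 * t) (by positivity)).2,
    (r2_spec (t := 2 * t) (by positivity)).2] at h
  have h' : r3 t ^ 2 = r3 (2 * t) * r3 (2 * t) + r2 (2 * t) * r2 (2 * t) := by exact_mod_cast h
  rw [h']; ring

lemma r2_sq {t : ℝ} (ht : 0 < t) : r2 t ^ 2 = 2 * r2 (2 * t) * r3 (2 * t) := by
  have h := A2_sq 0 ht
  rw [mul_zero, (r2_spec ht).2, (r3_spec (t := 2 * t) (by positivity)).2,
    (r2_spec (t := 2 * t) (by positivity)).2] at h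
  have h' : r2 t ^ 2 = r2 (2 * t) * r3 (2 * t) + r3 (2 * t) * r2 (2 * t) := by exact_mod_cast h
  rw [h']; ring

lemma r_id0 {t : ℝ} (ht : 0 < t) : r3 t ^ 4 = r2 t ^ 4 + r4 t ^ 4 := by
  have h := theta_id0 ht
  rw [(r2_spec ht).2, (r3_spec ht).2, (r4_spec ht).2] at h
  exact_mod_cast h

lemma r3_inv {t : ℝ} (ht : 0 < t) : r3 (1 / t) = √t * r3 t := by
  have h := A3_zero_inv ht
  rw [(r3_spec ht).2, (r3_spec (t := 1 / t) (by positivity)).2] at h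
  exact_mod_cast h

lemma r2_inv {t : ℝ} (ht : 0 < t) : r2 (1 / t) = √t * r4 t := by
  have h := A2_zero_inv ht
  rw [(r4_spec ht).2, (r2_spec (t := 1 / t) (by positivity)).2] at h
  exact_mod_cast h

/-- modulus -/
def kk (t : ℝ) : ℝ := r2 t ^ 2 / r3 t ^ 2

lemma kk_pos {t : ℝ} (ht : 0 < t) : 0 < kk t := by
  have := (r2_spec ht).1
  have := (r3_spec ht).1
  unfold kk; positivity

lemma kk_sq {t : ℝ} (ht : 0 < t) : kk t ^ 2 = 1 - (r4 t / r3 t) ^ 4 := by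
  have h3 := (r3_spec ht).1
  have := r_id0 ht
  unfold kk
  field_simp
  linarith

lemma kk_lt_one {t : ℝ} (ht : 0 < t) : kk t < 1 := by
  have h3 := (r3_spec ht).1
  have h4 := (r4_spec ht).1
  have h := kk_sq ht
  have : 0 < (r4 t / r3 t) ^ 4 := by positivity
  nlinarith [kk_pos ht]

lemma kk_inv {t : ℝ} (ht : 0 < t) : kk (1 / t) ^ 2 = 1 - kk t ^ 2 := by
  have h3 := (r3_spec ht).1
  have : 0 < √t := Real.sqrt_pos.mpr ht
  rw [kk_sq ht, kk, r2_inv ht, r3_inv ht]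
  field_simp
  ring

lemma K_step {t : ℝ} (ht : 0 < t) :
    Kre (kk t ^ 2) / r3 t ^ 2 = Kre (kk (2 * t) ^ 2) / r3 (2 * t) ^ 2 := by
  have ht2 : 0 < 2 * t := by positivity
  have h3 := (r3_spec ht).1
  have h32 := (r3_spec ht2).1
  have h22 := (r2_spec ht2).1
  have h := Kre_landen (kk_pos ht2) (kk_lt_one ht2)
  have hs : √(kk (2 * t)) = r2 (2 * t) / r3 (2 * t) := by
    rw [kk, ← div_pow, Real.sqrt_sq (by positivity)]
  have e1 : 1 + kk (2 * t) = r3 t ^ 2 / r3 (2 * t) ^ 2 := by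
    rw [r3_sq ht, kk]; field_simp
  have e2 : 2 * √(kk (2 * t)) / (1 + kk (2 * t)) = kk t := by
    rw [hs, e1, kk, r2_sq ht]; field_simp
  rw [e2, e1] at h
  rw [h]
  field_simp

lemma r3_tendsto : Tendsto r3 atTop (𝓝 1) := by
  have := (Complex.continuous_re.tendsto 1).comp A3_tendsto
  rw [Complex.one_re] at this
  exact this

lemma r2_tendsto : Tendsto r2 atTop (𝓝 0) := by
  have h1 := A2_tendsto 0
  have h2 := tendsto_exp_neg_mul (c := Real.pi / 4) (by positivity) 0
  have h3 := h2.mul h1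
  have h4 : Tendsto (fun t : ℝ => A2 0 t) atTop (𝓝 0) := by
    rw [zero_mul] at h3
    refine h3.congr fun t => ?_
    rw [← mul_assoc, ← Complex.exp_add]
    simp
  have := (Complex.continuous_re.tendsto 0).comp h4
  rw [Complex.zero_re] at this
  exact this

lemma kk_tendsto : Tendsto (fun t => kk t ^ 2) atTop (𝓝 0) := by
  have h := ((r2_tendsto.pow 2).div (r3_tendsto.pow 2) (by norm_num)).pow 2
  simpa [kk] using h

lemma Kre_theta {t : ℝ} (ht : 0 < t) : Kre (kk t ^ 2) = Kre 0 * r3 t ^ 2 := by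
  have all : ∀ n : ℕ, Kre (kk (2 ^ n * t) ^ 2) / r3 (2 ^ n * t) ^ 2 = Kre (kk t ^ 2) / r3 t ^ 2 := by
    intro n
    induction n with
    | zero => simp
    | succ k ih =>
      rw [← ih, K_step (t := 2 ^ k * t) (by positivity),
        show (2 : ℝ) ^ (k + 1) * t = 2 * (2 ^ k * t) by ring]
  have hT : Tendsto (fun n : ℕ => (2 : ℝ) ^ n * t) atTop atTop :=
    (tendsto_pow_atTop_atTop_of_one_lt one_lt_two).atTop_mul_const ht
  have hK : Tendsto (fun s => Kre (kk s ^ 2)) atTop (𝓝 (Kre 0)) := by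
    have hup : Tendsto (fun s => 1 / √(1 - kk s ^ 2) * Kre 0) atTop (𝓝 (Kre 0)) := by
      have h1 : Tendsto (fun s => √(1 - kk s ^ 2)) atTop (𝓝 1) := by
        have := (kk_tendsto.const_sub 1).sqrt
        simpa using this
      have := ((tendsto_const_nhds (x := (1 : ℝ))).div h1 one_ne_zero).mul_const (Kre 0)
      simpa using this
    refine tendsto_of_tendsto_of_tendsto_of_le_of_le' tendsto_const_nhds hup ?_ ?_
    · filter_upwards [eventually_gt_atTop 0] with s hs
      exact (Kre_bounds (sq_nonneg _) (by nlinarith [kk_pos hs, kk_lt_one hs])).1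
    · filter_upwards [eventually_gt_atTop 0] with s hs
      exact (Kre_bounds (sq_nonneg _) (by nlinarith [kk_pos hs, kk_lt_one hs])).2
  have hlim := (hK.div (r3_tendsto.pow 2) (by norm_num)).comp hT
  have hc : Tendsto (fun n : ℕ => Kre (kk t ^ 2) / r3 t ^ 2) atTop (𝓝 (Kre 0 / 1 ^ 2)) :=
    hlim.congr all
  have := tendsto_nhds_unique tendsto_const_nhds hc
  have h3 := (r3_spec ht).1
  rw [one_pow, div_one, div_eq_iff (by positivity)] at this
  exact this

lemma Kre_ratio {t : ℝ} (ht : 0 < t) : Kre (1 - kk t ^ 2) = t * Kre (kk t ^ 2) := by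
  rw [← kk_inv ht, Kre_theta (t := 1 / t) (by positivity), Kre_theta ht, r3_inv ht, mul_pow,
    Real.sq_sqrt ht.le]
  ring

lemma A3_cont (x : ℂ) : ContinuousOn (fun t : ℝ => A3 x t) (Ioi 0) := by
  intro t ht
  apply ContinuousAt.continuousWithinAt
  simp only [A3_eq]
  have h := (differentiableAt_jacobiTheta₂_snd (x / Real.pi) (τ := t * I)
    (by simpa using ht)).continuousAt
  exact ContinuousAt.comp (f := fun t : ℝ => (t : ℂ) * I) h (by fun_prop)

lemma kk_cont : ContinuousOn (fun t => kk t ^ 2) (Ioi 0) := by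
  have h3 : ContinuousOn r3 (Ioi 0) := Complex.continuous_re.comp_continuousOn (A3_cont 0)
  have h4 : ContinuousOn r4 (Ioi 0) :=
    Complex.continuous_re.comp_continuousOn (A3_cont (0 - Real.pi / 2))
  have : ContinuousOn (fun t => 1 - (r4 t / r3 t) ^ 4) (Ioi 0) :=
    continuousOn_const.sub ((h4.div h3 fun t ht => (r3_spec ht).1.ne').pow 4)
  exact this.congr fun t ht => kk_sq ht

lemma exists_kk {μ : ℝ} (h0 : 0 < μ) (h1 : μ < 1) : ∃ t, 0 < t ∧ kk t ^ 2 = μ := by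
  obtain ⟨a, ha0, ha⟩ := ((eventually_gt_atTop (0 : ℝ)).and
    (kk_tendsto.eventually_lt_const h0)).exists
  obtain ⟨b, hb0, hb⟩ := ((eventually_gt_atTop (0 : ℝ)).and
    (kk_tendsto.eventually_lt_const (sub_pos.mpr h1))).exists
  have hb' : μ < kk (1 / b) ^ 2 := by rw [kk_inv hb0]; linarith
  obtain ⟨t, ht, h⟩ := isPreconnected_Ioi.intermediate_value (s := Ioi (0 : ℝ))
    (show a ∈ Ioi (0 : ℝ) from ha0) (show 1 / b ∈ Ioi (0 : ℝ) by simpa using hb0) kk_cont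
    ⟨ha.le, hb'.le⟩
  exact ⟨t, ht, h⟩

lemma jac {u t : ℝ} (hu : u ∈ Ioo (0 : ℝ) 1) (ht : 0 < t) {μ : ℝ} (hμ : kk t ^ 2 = μ) :
    snR (KR μ * u) μ ^ 2 + cnR (KR μ * u) μ ^ 2 = 1 ∧
    dnR (KR μ * u) μ ^ 2 = 1 - μ * snR (KR μ * u) μ ^ 2 ∧ cnR (KR μ * u) μ ≠ 0 := by
  have hk0 := kk_pos ht
  have hk1 := kk_lt_one ht
  have hμ0 : 0 < μ := by rw [← hμ]; positivity
  have hμ1 : μ < 1 := by rw [← hμ]; nlinarith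
  have hKp := Kre_pos hμ0.le hμ1
  have hK := ellK_eq hμ1
  have hK' := ellK_eq (m := 1 - μ) (by linarith)
  have hr : Kre (1 - μ) = t * Kre μ := by rw [← hμ]; exact Kre_ratio ht
  have hKne : (Kre μ : ℂ) ≠ 0 := by exact_mod_cast hKp.ne'
  have hq : nome μ = Complex.exp (-(Real.pi : ℂ) * t) := by
    unfold nome
    rw [show (1 : ℂ) - μ = ((1 - μ : ℝ) : ℂ) by push_cast; ring, hK, hK', hr]
    congr 1
    push_cast
    field_simp
  have hKR : KR μ = Kre μ := by unfold KR; rw [hK, Complex.ofReal_re]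
  have harg : (Real.pi : ℂ) * ((KR μ * u : ℝ) : ℂ) / (2 * ellK μ) = ((Real.pi * u / 2 : ℝ) : ℂ) := by
    rw [hKR, hK]; push_cast; field_simp
  set x : ℝ := Real.pi * u / 2 with hx
  have hx0 : 0 < x := by have := Real.pi_pos; have := hu.1; positivity
  have hx1 : x < Real.pi / 2 := by have := Real.pi_pos; have := hu.2; rw [hx]; nlinarith
  obtain ⟨a1, h1⟩ := A1_real x t
  obtain ⟨a2, h2⟩ := A2_real x t
  obtain ⟨a3, h3p, h3⟩ := A3_real_pos x ht
  obtain ⟨a4, h4p, h4⟩ := A4_real_pos x ht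
  obtain ⟨p2, z2⟩ := r2_spec ht
  obtain ⟨p3, z3⟩ := r3_spec ht
  obtain ⟨p4, z4⟩ := r4_spec ht
  have h2ne : a2 ≠ 0 := by
    have := A2_ne_zero hx0 hx1 ht
    rw [h2] at this
    exact_mod_cast this
  have id1 := theta_id1 x ht
  have id2 := theta_id2 x ht
  rw [h1, h2, h4, z2, z3, z4] at id1
  rw [h1, h3, h4, z2, z3, z4] at id2
  have id1' : r2 t ^ 2 * a4 ^ 2 = r3 t ^ 2 * a1 ^ 2 + r4 t ^ 2 * a2 ^ 2 := by exact_mod_cast id1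
  have id2' : r3 t ^ 2 * a4 ^ 2 = r2 t ^ 2 * a1 ^ 2 + r4 t ^ 2 * a3 ^ 2 := by exact_mod_cast id2
  have hs : snR (KR μ * u) μ = r3 t / r2 t * (a1 / a4) := by
    unfold snR sn
    rw [harg, hq, theta1_eq _ ht, theta2_eq _ ht, theta3_eq _ ht, theta4_eq _ ht, h1, h4, z2, z3]
    exact_mod_cast Complex.ofReal_re _
  have hc : cnR (KR μ * u) μ = r4 t / r2 t * (a2 / a4) := by
    unfold cnR cn
    rw [harg, hq, theta2_eq _ ht, theta2_eq _ ht, theta4_eq _ ht, theta4_eq _ ht, h2, h4, z2, z4]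
    exact_mod_cast Complex.ofReal_re _
  have hd : dnR (KR μ * u) μ = r4 t / r3 t * (a3 / a4) := by
    unfold dnR dn
    rw [harg, hq, theta3_eq _ ht, theta3_eq _ ht, theta4_eq _ ht, theta4_eq _ ht, h3, h4, z3, z4]
    exact_mod_cast Complex.ofReal_re _
  rw [hs, hc, hd]
  refine ⟨?_, ?_, ?_⟩
  · field_simp
    linarith
  · rw [← hμ, kk]
    field_simp
    linarith
  · have := p4.ne'
    have := p2.ne'
    have := h4p.ne'
    positivity
/-- For `u ∈ (0,1)`, `m > 1`, `μ = 1/m`, `μ₁ = 1 − μ` and the usual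
abbreviations `s, c, d, s₁, c₁, d₁`, the identity
`μ(s²d₁² + c²d²s₁²c₁²)/(1 − d²s₁²)² = 1 − (c²c₁²/(1 − d²s₁²))(1 − φ(u,μ))`
holds, where `φ(u,μ) = (d₁/c₁)² − (d/c)²`. -/
theorem sn_abs_sq_identity (u m : ℝ) (hu : u ∈ Set.Ioo (0 : ℝ) 1) (hm : 1 < m)
    (μ μ₁ s c d s₁ c₁ d₁ : ℝ)
    (hμ : μ = 1 / m) (hμ₁ : μ₁ = 1 - μ)
    (hs : s = snR (KR μ * u) μ) (hc : c = cnR (KR μ * u) μ)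
    (hd : d = dnR (KR μ * u) μ)
    (hs₁ : s₁ = snR (KR μ₁ * u) μ₁) (hc₁ : c₁ = cnR (KR μ₁ * u) μ₁)
    (hd₁ : d₁ = dnR (KR μ₁ * u) μ₁) :
    μ * (s ^ 2 * d₁ ^ 2 + c ^ 2 * d ^ 2 * s₁ ^ 2 * c₁ ^ 2) / (1 - d ^ 2 * s₁ ^ 2) ^ 2 =
      1 - (c ^ 2 * c₁ ^ 2 / (1 - d ^ 2 * s₁ ^ 2)) *
        (1 - ((d₁ / c₁) ^ 2 - (d / c) ^ 2)) := by
  have hm0 : 0 < m := by linarith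
  have hμ0 : 0 < μ := by rw [hμ]; positivity
  have hμ1 : μ < 1 := by rw [hμ, div_lt_one hm0]; exact hm
  obtain ⟨t, ht, hk⟩ := exists_kk hμ0 hμ1
  have hk₁ : kk (1 / t) ^ 2 = μ₁ := by rw [kk_inv ht, hk, hμ₁]
  obtain ⟨e1, e2, e3⟩ := jac hu ht hk
  obtain ⟨f1, f2, f3⟩ := jac hu (t := 1 / t) (by positivity) hk₁
  rw [← hs, ← hc] at e1
  rw [← hs, ← hd] at e2
  rw [← hc] at e3
  rw [← hs₁, ← hc₁] at f1
  rw [← hs₁, ← hd₁] at f2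
  rw [← hc₁] at f3
  have hc2 : c ^ 2 = 1 - s ^ 2 := by linarith
  have hc12 : c₁ ^ 2 = 1 - s₁ ^ 2 := by linarith
  have hs1lt : s₁ ^ 2 < 1 := by
    have : 0 < c₁ ^ 2 := by positivity
    linarith
  have hd1 : d ^ 2 ≤ 1 := by rw [e2]; nlinarith [mul_nonneg hμ0.le (sq_nonneg s)]
  have hD : 0 < 1 - d ^ 2 * s₁ ^ 2 := by nlinarith [sq_nonneg s₁]
  have key : c ^ 2 * c₁ ^ 2 * (1 - ((d₁ / c₁) ^ 2 - (d / c) ^ 2)) =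
      c ^ 2 * c₁ ^ 2 - c ^ 2 * d₁ ^ 2 + d ^ 2 * c₁ ^ 2 := by
    field_simp
    ring
  rw [div_mul_eq_mul_div, key]
  have hD' := hD.ne'
  rw [eq_sub_iff_add_eq, div_add_div _ _ (by positivity) hD', div_eq_one_iff_eq (by positivity)]
  rw [hμ₁] at f2
  rw [e2]
  rw [f2, hc2, hc12]
  ring
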